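/- Let N ≥ 5, a, b > 0, g : ℝ → ℝ, and suppose v̄ ∈ C²(ℝ^N) with V = ∫_{ℝ^N}|∇v̄|² satisfying 0 < V < ∞ and −Δv̄ = g(v̄) on ℝ^N. Then there exists t > 0 such that u = v̄(t·) satisfies the Kirchhoff equation −(a + b∫_{ℝ^N}|∇u|²)·Δu = g(u) on ℝ^N if and only if a ≤ ((N−4)/(N−2))^{(N−2)/(N−4)} · (2/((N−4)·b·V))^{2/(N−4)}. -/

import Mathlib

open MeasureTheory

/-- The Laplacian of `u : ℝ^N → ℝ`, as the sum of second partial derivatives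
along the standard basis directions. -/
noncomputable def lap {N : ℕ} (u : EuclideanSpace ℝ (Fin N) → ℝ)
    (x : EuclideanSpace ℝ (Fin N)) : ℝ :=
  ∑ i : Fin N,
    fderiv ℝ (fun y => fderiv ℝ u y (EuclideanSpace.single i 1)) x (EuclideanSpace.single i 1)

/-- The Dirichlet energy `∫_{ℝ^N} |∇u|²`. -/
noncomputable def dirichlet {N : ℕ} (u : EuclideanSpace ℝ (Fin N) → ℝ) : ℝ :=
  ∫ x, ‖gradient u x‖ ^ 2

lemma integral_fderiv_apply_eq_zero_of_hasCompactSupport {E : Type*} [NormedAddCommGroup E]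
    [NormedSpace ℝ E] [FiniteDimensional ℝ E] [MeasurableSpace E] [BorelSpace E]
    (μ : Measure E) [μ.IsAddHaarMeasure] {f : E → ℝ} (hf : ContDiff ℝ 1 f)
    (hc : HasCompactSupport f) (e : E) : ∫ x, fderiv ℝ f x e ∂μ = 0 := by
  have hi : Integrable f μ := hf.continuous.integrable_of_hasCompactSupport hc
  have hi' : Integrable (fun x => fderiv ℝ f x e) μ :=
    ((hf.continuous_fderiv one_ne_zero).clm_apply continuous_const).integrable_of_hasCompactSupport
      (hc.fderiv_apply (𝕜 := ℝ) e)
  have h := integral_mul_fderiv_eq_neg_fderiv_mul_of_integrable (μ := μ) (v := e)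
    (f := fun _ : E => (1 : ℝ)) (g := f) (by simp) (by simpa using hi') (by simpa using hi)
    (fun x _ => by fun_prop) (fun x _ => hf.differentiable one_ne_zero x)
  simpa using h

lemma norm_gradient_eq_norm_fderiv {E : Type*} [NormedAddCommGroup E] [InnerProductSpace ℝ E]
    [CompleteSpace E] (u : E → ℝ) (x : E) : ‖gradient u x‖ = ‖fderiv ℝ u x‖ := by
  rw [← toDual_gradient, LinearIsometryEquiv.norm_map]

lemma norm_sq_eq_sum_apply_single {N : ℕ} (L : EuclideanSpace ℝ (Fin N) →L[ℝ] ℝ) :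
    ‖L‖ ^ 2 = ∑ i, L (EuclideanSpace.single i 1) ^ 2 := by
  obtain ⟨y, rfl⟩ := (InnerProductSpace.toDual ℝ (EuclideanSpace ℝ (Fin N))).surjective L
  rw [LinearIsometryEquiv.norm_map, EuclideanSpace.norm_sq_eq]
  simp [EuclideanSpace.inner_single_right]

lemma apply_eq_sum_mul_apply_single {N : ℕ} (L : EuclideanSpace ℝ (Fin N) →L[ℝ] ℝ)
    (x : EuclideanSpace ℝ (Fin N)) : L x = ∑ i, x i * L (EuclideanSpace.single i 1) := by
  conv_lhs => rw [← (EuclideanSpace.basisFun (Fin N) ℝ).sum_repr x]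
  simp

/-- Divergence of the Pohozaev field `φ ((x·∇v) ∇v - ½ |∇v|² x)` for a harmonic `v`. -/
lemma sum_fderiv_pohozaev_field {N : ℕ} {v φ : EuclideanSpace ℝ (Fin N) → ℝ}
    (hv : ContDiff ℝ 2 v) (hφ : ContDiff ℝ 1 φ) (x : EuclideanSpace ℝ (Fin N))
    (hx : lap v x = 0) :
    ∑ i, fderiv ℝ (fun y => φ y * (fderiv ℝ v y y * fderiv ℝ v y (EuclideanSpace.single i 1)
        - 1 / 2 * (∑ j, fderiv ℝ v y (EuclideanSpace.single j 1) ^ 2) * y i)) x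
        (EuclideanSpace.single i 1)
      = (∑ i, fderiv ℝ φ x (EuclideanSpace.single i 1) *
            fderiv ℝ v x (EuclideanSpace.single i 1)) * fderiv ℝ v x x
        + (1 - (N : ℝ) / 2) * φ x * ‖fderiv ℝ v x‖ ^ 2
        - 1 / 2 * ‖fderiv ℝ v x‖ ^ 2 * fderiv ℝ φ x x := by
  have hD : Differentiable ℝ (fderiv ℝ v) :=
    (hv.fderiv_right (m := 1) (by norm_num)).differentiable one_ne_zero
  set D := fderiv ℝ v with hDdef
  set D' := fderiv ℝ D x with hD'
  have hDx : HasFDerivAt D D' x := (hD x).hasFDerivAt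
  have hφx : HasFDerivAt φ (fderiv ℝ φ x) x := (hφ.differentiable one_ne_zero x).hasFDerivAt
  have hsymm : ∀ p q, D' p q = D' q p := fun p q =>
    (hv.contDiffAt.isSymmSndFDerivAt (by simp)) p q
  have happ : ∀ w, HasFDerivAt (fun y => D y w) (D'.flip w) x := fun w => by
    convert! hDx.clm_apply (hasFDerivAt_const w x) using 1
    ext; simp
  have hself : HasFDerivAt (fun y => D y y) (D x + D'.flip x) x := by
    convert! hDx.clm_apply (hasFDerivAt_id x) using 1
  have hlap : ∑ i, D' (EuclideanSpace.single i 1) (EuclideanSpace.single i 1) = 0 := by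
    rw [← hx, lap]
    refine Finset.sum_congr rfl fun i _ => ?_
    rw [(happ _).fderiv]; rfl
  have hder : ∀ i, fderiv ℝ (fun y => φ y * (D y y * D y (EuclideanSpace.single i 1)
        - 1 / 2 * (∑ j, D y (EuclideanSpace.single j 1) ^ 2) * y i)) x
        (EuclideanSpace.single i 1)
      = fderiv ℝ φ x (EuclideanSpace.single i 1) * D x (EuclideanSpace.single i 1) * D x x
        - 1 / 2 * ‖D x‖ ^ 2 * (x i * fderiv ℝ φ x (EuclideanSpace.single i 1))
        + φ x * D x (EuclideanSpace.single i 1) ^ 2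
        + φ x * (D' x (EuclideanSpace.single i 1) * D x (EuclideanSpace.single i 1))
        + φ x * D x x * D' (EuclideanSpace.single i 1) (EuclideanSpace.single i 1)
        - φ x * (x i * ∑ j, D x (EuclideanSpace.single j 1) *
            D' (EuclideanSpace.single i 1) (EuclideanSpace.single j 1))
        - 1 / 2 * φ x * ‖D x‖ ^ 2 := by
    intro i
    have hS : HasFDerivAt (fun y => ∑ j, D y (EuclideanSpace.single j 1) ^ 2)
        (∑ j, (2 * D x (EuclideanSpace.single j 1)) • D'.flip (EuclideanSpace.single j 1)) x := by
      refine HasFDerivAt.fun_sum fun j _ => ?_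
      simpa using (happ (EuclideanSpace.single j 1)).pow 2
    have hcoord : HasFDerivAt (fun y : EuclideanSpace ℝ (Fin N) => y i)
        (EuclideanSpace.proj i : EuclideanSpace ℝ (Fin N) →L[ℝ] ℝ) x :=
      (EuclideanSpace.proj i : EuclideanSpace ℝ (Fin N) →L[ℝ] ℝ).hasFDerivAt
    have h := hφx.mul ((hself.mul (happ (EuclideanSpace.single i 1))).sub
      ((hS.const_mul (1 / 2)).mul hcoord))
    refine (congrArg (fun L => L (EuclideanSpace.single i 1)) h.fderiv).trans ?_
    rw [norm_sq_eq_sum_apply_single, hsymm x]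
    simp [Finset.mul_sum, mul_assoc]
    simp only [← Finset.mul_sum]
    ring
  simp_rw [hder]
  simp only [Finset.sum_add_distrib, Finset.sum_sub_distrib, ← Finset.mul_sum,
    ← Finset.sum_mul, hlap, ← apply_eq_sum_mul_apply_single, ← norm_sq_eq_sum_apply_single]
  have hswap : ∑ i, x i * ∑ j, D x (EuclideanSpace.single j 1) *
        D' (EuclideanSpace.single i 1) (EuclideanSpace.single j 1)
      = ∑ j, D' x (EuclideanSpace.single j 1) * D x (EuclideanSpace.single j 1) := by
    simp only [Finset.mul_sum]
    rw [Finset.sum_comm]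
    refine Finset.sum_congr rfl fun j _ => ?_
    rw [hsymm x, apply_eq_sum_mul_apply_single (D' (EuclideanSpace.single j 1)) x, Finset.sum_mul]
    refine Finset.sum_congr rfl fun i _ => ?_
    rw [hsymm]; ring
  rw [hswap]
  simp
  ring

lemma integral_pohozaev_eq_zero {N : ℕ} {v φ : EuclideanSpace ℝ (Fin N) → ℝ}
    (hv : ContDiff ℝ 2 v) (hlap : ∀ x, lap v x = 0) (hφ : ContDiff ℝ 1 φ)
    (hc : HasCompactSupport φ) :
    ∫ x, ((∑ i, fderiv ℝ φ x (EuclideanSpace.single i 1) *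
            fderiv ℝ v x (EuclideanSpace.single i 1)) * fderiv ℝ v x x
        + (1 - (N : ℝ) / 2) * φ x * ‖fderiv ℝ v x‖ ^ 2
        - 1 / 2 * ‖fderiv ℝ v x‖ ^ 2 * fderiv ℝ φ x x) = 0 := by
  have hD : ContDiff ℝ 1 (fderiv ℝ v) := hv.fderiv_right (by norm_num)
  have hF : ∀ i : Fin N, ContDiff ℝ 1 (fun y => φ y * (fderiv ℝ v y y *
      fderiv ℝ v y (EuclideanSpace.single i 1)
        - 1 / 2 * (∑ j, fderiv ℝ v y (EuclideanSpace.single j 1) ^ 2) * y i)) := fun i => by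
    fun_prop
  have hFc : ∀ i : Fin N, HasCompactSupport (fun y => φ y * (fderiv ℝ v y y *
      fderiv ℝ v y (EuclideanSpace.single i 1)
        - 1 / 2 * (∑ j, fderiv ℝ v y (EuclideanSpace.single j 1) ^ 2) * y i)) := fun i =>
    hc.mul_right
  simp_rw [← fun x => sum_fderiv_pohozaev_field hv hφ x (hlap x)]
  rw [integral_finsetSum]
  · exact Finset.sum_eq_zero fun i _ =>
      integral_fderiv_apply_eq_zero_of_hasCompactSupport volume (hF i) (hFc i) _
  · exact fun i _ => (((hF i).continuous_fderiv one_ne_zero).clm_apply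
      continuous_const).integrable_of_hasCompactSupport ((hFc i).fderiv_apply (𝕜 := ℝ) _)

/-- In dimension other than two, a harmonic function of finite Dirichlet energy has energy zero. -/
lemma dirichlet_eq_zero_of_lap_eq_zero {N : ℕ} (hN : N ≠ 2) {v : EuclideanSpace ℝ (Fin N) → ℝ}
    (hv : ContDiff ℝ 2 v) (hlap : ∀ x, lap v x = 0)
    (hint : Integrable (fun x => ‖gradient v x‖ ^ 2)) : dirichlet v = 0 := by
  simp only [dirichlet, norm_gradient_eq_norm_fderiv] at hint ⊢
  have hD : Continuous (fderiv ℝ v) := hv.continuous_fderiv two_ne_zero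
  let η : ContDiffBump (0 : EuclideanSpace ℝ (Fin N)) := ⟨1, 2, one_pos, one_lt_two⟩
  have hη : ContDiff ℝ 1 η := η.contDiff
  have hη' : Continuous (fderiv ℝ η) := hη.continuous_fderiv one_ne_zero
  obtain ⟨C, hC⟩ : ∃ C, ∀ z, ‖‖fderiv ℝ η z‖ * ‖z‖‖ ≤ C :=
    (hη'.norm.mul continuous_norm).bounded_above_of_compact_support
      ((η.hasCompactSupport.fderiv (𝕜 := ℝ)).norm.mul_right)
  let F : ℝ → EuclideanSpace ℝ (Fin N) → ℝ := fun c x =>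
    (∑ i, fderiv ℝ η (c • x) (EuclideanSpace.single i 1) *
            fderiv ℝ v x (EuclideanSpace.single i 1)) * fderiv ℝ v x (c • x)
        + (1 - (N : ℝ) / 2) * η (c • x) * ‖fderiv ℝ v x‖ ^ 2
        - 1 / 2 * ‖fderiv ℝ v x‖ ^ 2 * fderiv ℝ η (c • x) (c • x)
  have hF0 : ∀ c ≠ 0, ∫ x, F c x = 0 := fun c hc => by
    have hcη : ContDiff ℝ 1 (fun x => η (c • x)) := by fun_prop
    have h := integral_pohozaev_eq_zero hv hlap hcη
      (η.hasCompactSupport.comp_smul hc)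
    simp only [fderiv_comp_smul] at h
    rw [← h]
    refine integral_congr_ae (Filter.Eventually.of_forall fun x => ?_)
    simp only [F, map_smul, smul_apply, smul_eq_mul, mul_assoc, ← Finset.mul_sum]
    ring
  have hlim : Filter.Tendsto (fun c => ∫ x, F c x) (nhdsWithin 0 {0}ᶜ)
      (nhds (∫ x, (1 - (N : ℝ) / 2) * ‖fderiv ℝ v x‖ ^ 2)) := by
    refine tendsto_integral_filter_of_dominated_convergence
      (fun x => ((N : ℝ) * C + |1 - (N : ℝ) / 2| + 1 / 2 * C) * ‖fderiv ℝ v x‖ ^ 2) ?_ ?_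
      (hint.const_mul _) ?_
    · refine Filter.Eventually.of_forall fun c => Continuous.aestronglyMeasurable ?_
      have := η.continuous
      fun_prop
    · refine Filter.Eventually.of_forall fun c => Filter.Eventually.of_forall fun x => ?_
      have hC' : ‖fderiv ℝ η (c • x)‖ * ‖c • x‖ ≤ C := (le_abs_self _).trans (hC (c • x))
      have h1 : ‖(∑ i, fderiv ℝ η (c • x) (EuclideanSpace.single i 1) *
            fderiv ℝ v x (EuclideanSpace.single i 1)) * fderiv ℝ v x (c • x)‖
          ≤ (N * C) * ‖fderiv ℝ v x‖ ^ 2 := by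
        have hs : ‖∑ i, fderiv ℝ η (c • x) (EuclideanSpace.single i 1) *
            fderiv ℝ v x (EuclideanSpace.single i 1)‖
            ≤ N * (‖fderiv ℝ η (c • x)‖ * ‖fderiv ℝ v x‖) := by
          refine (norm_sum_le _ _).trans ((Finset.sum_le_card_nsmul _ _
            (‖fderiv ℝ η (c • x)‖ * ‖fderiv ℝ v x‖) fun i _ => ?_).trans (by simp))
          rw [norm_mul]
          gcongr
          · simpa using (fderiv ℝ η (c • x)).le_opNorm (EuclideanSpace.single i 1)
          · simpa using (fderiv ℝ v x).le_opNorm (EuclideanSpace.single i 1)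
        calc _ ≤ (N * (‖fderiv ℝ η (c • x)‖ * ‖fderiv ℝ v x‖)) *
              (‖fderiv ℝ v x‖ * ‖c • x‖) := by
              rw [norm_mul]
              gcongr
              exact (fderiv ℝ v x).le_opNorm _
          _ = (N * (‖fderiv ℝ η (c • x)‖ * ‖c • x‖)) * ‖fderiv ℝ v x‖ ^ 2 := by ring
          _ ≤ _ := by gcongr
      have h2 : ‖(1 - (N : ℝ) / 2) * η (c • x) * ‖fderiv ℝ v x‖ ^ 2‖
          ≤ |1 - (N : ℝ) / 2| * ‖fderiv ℝ v x‖ ^ 2 := by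
        rw [norm_mul, norm_mul, Real.norm_eq_abs, Real.norm_of_nonneg η.nonneg,
          Real.norm_of_nonneg (sq_nonneg _)]
        gcongr
        exact mul_le_of_le_one_right (abs_nonneg _) η.le_one
      have h3 : ‖1 / 2 * ‖fderiv ℝ v x‖ ^ 2 * fderiv ℝ η (c • x) (c • x)‖
          ≤ 1 / 2 * C * ‖fderiv ℝ v x‖ ^ 2 := by
        rw [norm_mul, Real.norm_of_nonneg (by positivity : 0 ≤ 1 / 2 * ‖fderiv ℝ v x‖ ^ 2),
          mul_right_comm]
        have := ((fderiv ℝ η (c • x)).le_opNorm (c • x)).trans hC'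
        gcongr
      refine (norm_sub_le _ _).trans ?_
      grw [norm_add_le]
      linarith
    · refine Filter.Eventually.of_forall fun x => ?_
      have hcont : Continuous fun c => F c x := by
        have := η.continuous
        fun_prop
      have h0 : F 0 x = (1 - (N : ℝ) / 2) * ‖fderiv ℝ v x‖ ^ 2 := by
        have : η 0 = 1 := η.one_of_mem_closedBall (by simp [η])
        simp [F, this]
      rw [← h0]
      exact (hcont.tendsto 0).mono_left nhdsWithin_le_nhds
  have hzero : ∫ x, (1 - (N : ℝ) / 2) * ‖fderiv ℝ v x‖ ^ 2 = 0 := by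
    refine tendsto_nhds_unique hlim (tendsto_const_nhds.congr' ?_)
    filter_upwards [self_mem_nhdsWithin] with c hc
    exact (hF0 c hc).symm
  rw [integral_const_mul] at hzero
  refine (mul_eq_zero.mp hzero).resolve_left fun h => hN ?_
  have : (N : ℝ) = 2 := by linarith
  exact_mod_cast this

lemma lap_comp_smul {N : ℕ} (v : EuclideanSpace ℝ (Fin N) → ℝ) (t : ℝ)
    (x : EuclideanSpace ℝ (Fin N)) :
    lap (fun y => v (t • y)) x = t ^ 2 * lap v (t • x) := by
  simp only [lap, fderiv_comp_smul, smul_apply, Finset.mul_sum]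
  refine Finset.sum_congr rfl fun i _ => ?_
  change fderiv ℝ (t • fun y => fderiv ℝ v (t • y) (EuclideanSpace.single i 1)) x
    (EuclideanSpace.single i 1) = _
  rw [fderiv_const_smul_field, Pi.smul_apply, smul_apply,
    fderiv_comp_smul (f := fun y => fderiv ℝ v y (EuclideanSpace.single i 1))]
  simp only [smul_apply, smul_eq_mul]
  ring

lemma dirichlet_comp_smul {N : ℕ} (v : EuclideanSpace ℝ (Fin N) → ℝ) {t : ℝ} (ht : 0 < t) :
    dirichlet (fun y => v (t • y)) = t ^ 2 * ((t ^ N)⁻¹ * dirichlet v) := by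
  simp only [dirichlet, norm_gradient_eq_norm_fderiv, fderiv_comp_smul, norm_smul, mul_pow]
  rw [integral_const_mul, Measure.integral_comp_smul volume (fun y => ‖fderiv ℝ v y‖ ^ 2) t]
  simp [abs_of_pos ht]

lemma mul_sq_le_add_two_mul_pow {r : ℝ} (hr : 0 ≤ r) (m : ℕ) :
    ((m : ℝ) + 2) * r ^ 2 ≤ m + 2 * r ^ (m + 2) := by
  have hm : (0 : ℝ) ≤ m := m.cast_nonneg
  have h := one_add_mul_self_le_rpow_one_add (s := r ^ 2 - 1) (by nlinarith)
    (p := ((m : ℝ) + 2) / 2) (by linarith)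
  have e : (1 + (r ^ 2 - 1)) ^ (((m : ℝ) + 2) / 2) = r ^ (m + 2) := by
    rw [add_sub_cancel, ← Real.rpow_natCast r 2, ← Real.rpow_mul hr, ← Real.rpow_natCast]
    congr 1
    push_cast
    ring
  rw [e] at h
  linarith

/-- A positive `a` is a value of `s² - K s^(m+2)` on `s > 0` iff it is at most the maximum there. -/
lemma exists_add_mul_pow_eq_sq_iff {m : ℕ} (hm : 1 ≤ m) {a K : ℝ} (ha : 0 < a) (hK : 0 < K) :
    (∃ s : ℝ, 0 < s ∧ a + K * s ^ (m + 2) = s ^ 2) ↔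
    a ≤ ((m : ℝ) / (m + 2)) ^ (((m : ℝ) + 2) / m) * (2 / ((m : ℝ) * K)) ^ ((2 : ℝ) / m) := by
  have hm0 : (0 : ℝ) < m := by exact_mod_cast hm
  set σ : ℝ := (2 / (K * (m + 2))) ^ ((1 : ℝ) / m) with hσ
  have hσpos : 0 < σ := by positivity
  have hσm : K * σ ^ m = 2 / (m + 2) := by
    rw [hσ, ← Real.rpow_natCast, ← Real.rpow_mul (by positivity), one_div_mul_cancel hm0.ne',
      Real.rpow_one]
    field_simp
  have hmax : ((m : ℝ) / (m + 2)) ^ (((m : ℝ) + 2) / m) * (2 / ((m : ℝ) * K)) ^ ((2 : ℝ) / m)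
      = m / (m + 2) * σ ^ 2 := by
    have e : ((m : ℝ) + 2) / m = 1 + 2 / m := by field_simp
    rw [e, Real.rpow_add (by positivity), Real.rpow_one, mul_assoc,
      ← Real.mul_rpow (by positivity) (by positivity), hσ, ← Real.rpow_natCast (_ ^ _) 2,
      ← Real.rpow_mul (by positivity)]
    congr 2
    · field_simp
    · push_cast; ring
  have hval : ∀ r, (σ * r) ^ 2 - K * (σ * r) ^ (m + 2)
      = σ ^ 2 * (r ^ 2 - 2 / (m + 2) * r ^ (m + 2)) := fun r => by
    rw [← hσm]; ring
  rw [hmax]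
  constructor
  · rintro ⟨s, hs, hsa⟩
    have h := hval (s / σ)
    rw [mul_div_cancel₀ _ hσpos.ne'] at h
    have h2 := mul_sq_le_add_two_mul_pow (div_pos hs hσpos).le m
    have h3 : (s / σ) ^ 2 - 2 / (m + 2) * (s / σ) ^ (m + 2) ≤ m / (m + 2) := by
      rw [div_mul_eq_mul_div, sub_le_iff_le_add, ← add_div, le_div_iff₀ (by positivity)]
      linarith
    calc a = s ^ 2 - K * s ^ (m + 2) := by linarith
      _ = _ := h
      _ ≤ σ ^ 2 * (m / (m + 2)) := by gcongr
      _ = _ := mul_comm _ _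
  · intro hle
    have hcont : ContinuousOn (fun s : ℝ => s ^ 2 - K * s ^ (m + 2)) (Set.Icc 0 σ) := by fun_prop
    have hσval : σ ^ 2 - K * σ ^ (m + 2) = m / (m + 2) * σ ^ 2 := by
      have h := hval 1
      simp only [mul_one, one_pow] at h
      rw [h]
      field_simp
      ring
    obtain ⟨s, hs, hsa⟩ := intermediate_value_Icc hσpos.le hcont
      (show a ∈ Set.Icc _ _ from ⟨by simpa using ha.le, by simpa only [hσval] using hle⟩)
    refine ⟨s, lt_of_le_of_ne hs.1 fun h => ?_, by simp only at hsa; linarith⟩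
    simp [← h] at hsa
    exact ha.ne hsa

theorem stmt15 {N : ℕ} (hN : 5 ≤ N) (a b : ℝ) (ha : 0 < a) (hb : 0 < b)
    (g : ℝ → ℝ) (v : EuclideanSpace ℝ (Fin N) → ℝ)
    (hv : ContDiff ℝ 2 v)
    (V : ℝ) (hV : V = dirichlet v) (hVpos : 0 < V)
    (hvInt : Integrable (fun x => ‖gradient v x‖ ^ 2))
    (hvEq : ∀ x, -lap v x = g (v x)) :
    (∃ t : ℝ, 0 < t ∧
      ∀ x, -((a + b * dirichlet (fun y => v (t • y))) * lap (fun y => v (t • y)) x)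
          = g (v (t • x))) ↔
    a ≤ (((N : ℝ) - 4) / (N - 2)) ^ (((N : ℝ) - 2) / (N - 4)) *
        (2 / (((N : ℝ) - 4) * (b * V))) ^ ((2 : ℝ) / (N - 4)) := by
  obtain ⟨x₀, hx₀⟩ : ∃ x, lap v x ≠ 0 := by
    by_contra! h
    exact hVpos.ne' (hV.trans (dirichlet_eq_zero_of_lap_eq_zero (by omega) hv h hvInt))
  obtain ⟨m, rfl⟩ : ∃ m, N = m + 4 := ⟨N - 4, by omega⟩
  have hN4 : ((m + 4 : ℕ) : ℝ) - 4 = m := by push_cast; ring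
  have hN2 : ((m + 4 : ℕ) : ℝ) - 2 = m + 2 := by push_cast; ring
  rw [hN4, hN2, ← exists_add_mul_pow_eq_sq_iff (by omega) ha (mul_pos hb hVpos)]
  have key : ∀ t : ℝ, 0 < t → ((∀ x, -((a + b * dirichlet (fun y => v (t • y))) *
      lap (fun y => v (t • y)) x) = g (v (t • x))) ↔
      a + b * V * t⁻¹ ^ (m + 2) = t⁻¹ ^ 2) := by
    intro t ht
    have hcoef : (a + b * dirichlet (fun y => v (t • y))) * t ^ 2 = 1 ↔
        a + b * V * t⁻¹ ^ (m + 2) = t⁻¹ ^ 2 := by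
      have e : b * dirichlet (fun y => v (t • y)) = b * V * t⁻¹ ^ (m + 2) := by
        rw [dirichlet_comp_smul v ht, ← hV, inv_pow]
        field_simp
        ring
      rw [e, inv_pow t 2, ← mul_eq_one_iff_eq_inv₀ (by positivity)]
    rw [← hcoef]
    simp only [lap_comp_smul, ← hvEq, neg_inj, ← mul_assoc]
    constructor
    · intro h
      have h0 := h (t⁻¹ • x₀)
      rw [smul_inv_smul₀ ht.ne'] at h0
      exact mul_right_cancel₀ hx₀ (h0.trans (one_mul _).symm)
    · intro h x
      rw [h, one_mul]
  constructor
  · rintro ⟨t, ht, h⟩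
    exact ⟨t⁻¹, inv_pos.mpr ht, (key t ht).mp h⟩
  · rintro ⟨s, hs, h⟩
    exact ⟨s⁻¹, inv_pos.mpr hs, (key _ (inv_pos.mpr hs)).mpr (by simpa only [inv_inv] using h)⟩
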